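/- Let X be a topological space and let κ be an infinite cardinal number. Then the following conditions are equivalent: (i) every point-finite family of nonempty functionally open subsets of X has cardinality at most κ; (ii) every Valdivia compact space Y contained in C_p(X) has topological weight at most κ; (iii) every Eberlein compact space Y contained in C_p(X) has topological weight at most κ. -/

import Mathlib

open Cardinal Set

universe u v

/-- A subset `A` of a topological space is *functionally open* if `A = g⁻¹((0,1])`
for some continuous `g : X → [0,1]`. -/
def FunctionallyOpen {X : Type u} [TopologicalSpace X] (A : Set X) : Prop :=
  ∃ g : X → ℝ, Continuous g ∧ (∀ x, g x ∈ Set.Icc (0 : ℝ) 1) ∧ A = g ⁻¹' Set.Ioc (0 : ℝ) 1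

/-- A family of sets is *point-finite* if every point belongs to only finitely many members. -/
def PointFinite {X : Type u} (𝒰 : Set (Set X)) : Prop :=
  ∀ x : X, {U ∈ 𝒰 | x ∈ U}.Finite

/-- The point-finite cellularity `p(X)`: the supremum of the cardinalities of
point-finite families of nonempty open subsets of `X`. -/
noncomputable def pCell (X : Type u) [TopologicalSpace X] : Cardinal.{u} :=
  ⨆ 𝒰 : {𝒰 : Set (Set X) // (∀ U ∈ 𝒰, IsOpen U ∧ U.Nonempty) ∧ PointFinite 𝒰},
    Cardinal.mk ↥𝒰.1

/-- The cellularity `c(X)`: the supremum of the cardinalities of disjoint families of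
nonempty open subsets of `X`. -/
noncomputable def cellularity (X : Type u) [TopologicalSpace X] : Cardinal.{u} :=
  ⨆ 𝒰 : {𝒰 : Set (Set X) // (∀ U ∈ 𝒰, IsOpen U ∧ U.Nonempty) ∧ 𝒰.PairwiseDisjoint id},
    Cardinal.mk ↥𝒰.1

/-- The weight `w(X)`: the least infinite cardinality of a base of the topology of `X`. -/
noncomputable def tWeight (X : Type u) [TopologicalSpace X] : Cardinal.{u} :=
  ⨅ B : {B : Set (Set X) // TopologicalSpace.IsTopologicalBasis B},
    max Cardinal.aleph0 (Cardinal.mk ↥B.1)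

/-- The density `d(X)`: the least infinite cardinality of a dense subset of `X`. -/
noncomputable def tDensity (X : Type u) [TopologicalSpace X] : Cardinal.{u} :=
  ⨅ D : {D : Set X // Dense D}, max Cardinal.aleph0 (Cardinal.mk ↥D.1)

/-- `C_p(X)`: the continuous real valued functions on `X`, as a subspace of `ℝ^X` with
the product topology, i.e. with the topology of pointwise convergence. -/
def Cp (X : Type u) [TopologicalSpace X] : Set (X → ℝ) := {f | Continuous f}

/-- A compact space is *Valdivia* if it is homeomorphic to a compact subspace `Z ⊆ ℝ^T`
for some set `T` such that the countably supported elements of `Z` are dense in `Z`. -/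
def IsValdivia (Y : Type u) [TopologicalSpace Y] : Prop :=
  CompactSpace Y ∧ ∃ (T : Type u) (Z : Set (T → ℝ)), IsCompact Z ∧
    Dense {z : ↥Z | Set.Countable {t : T | (z : T → ℝ) t ≠ 0}} ∧ Nonempty (Y ≃ₜ ↥Z)

/-- A compact space is *Eberlein* if it is homeomorphic to a weakly compact subset of a
Banach space. -/
def IsEberlein (Y : Type u) [TopologicalSpace Y] : Prop :=
  CompactSpace Y ∧ ∃ (E : Type u) (_ : NormedAddCommGroup E) (_ : NormedSpace ℝ E)
    (_ : CompleteSpace E), ∃ K : Set (WeakSpace ℝ E), IsCompact K ∧ Nonempty (Y ≃ₜ ↥K)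


open Filter Topology
open scoped Cardinal

section Weight

lemma tWeight_le_of_basis {Y : Type u} [TopologicalSpace Y] {κ : Cardinal.{u}} (hκ : ℵ₀ ≤ κ)
    {B : Set (Set Y)} (hB : TopologicalSpace.IsTopologicalBasis B) (hBκ : #B ≤ κ) :
    tWeight Y ≤ κ :=
  (ciInf_le' _ (⟨B, hB⟩ : {B : Set (Set Y) // TopologicalSpace.IsTopologicalBasis B})).trans
    (max_le hκ hBκ)

/-- A family of open singletons injects into every base. -/
lemma mk_le_tWeight {Y T : Type u} [TopologicalSpace Y] (a : T → Y) (ha : Function.Injective a)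
    (hopen : ∀ t, IsOpen {a t}) : #T ≤ tWeight Y := by
  have : Nonempty {B : Set (Set Y) // TopologicalSpace.IsTopologicalBasis B} :=
    ⟨⟨_, TopologicalSpace.isTopologicalBasis_opens⟩⟩
  refine le_ciInf fun ⟨B, hB⟩ => le_max_of_le_right ?_
  have hmem (t : T) : {a t} ∈ B := by
    obtain ⟨V, hVB, htV, hV⟩ := hB.exists_subset_of_mem_open (mem_singleton (a t)) (hopen t)
    rwa [← hV.antisymm (singleton_subset_iff.2 htV)]
  refine mk_le_of_injective (f := fun t => (⟨{a t}, hmem t⟩ : B)) fun s t hst => ha ?_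
  simpa using hst

lemma mk_finset_le_of_le {α : Type u} {κ : Cardinal.{u}} (hκ : ℵ₀ ≤ κ) (hs : #α ≤ κ) :
    #(Finset α) ≤ κ := by
  cases finite_or_infinite α
  · exact (mk_le_aleph0_iff.2 inferInstance).trans hκ
  · rwa [mk_finset_of_infinite]

lemma mk_iUnion_le_of_le {ι α : Type u} {κ : Cardinal.{u}} (hκ : ℵ₀ ≤ κ) {f : ι → Set α}
    (hι : #ι ≤ κ) (hf : ∀ i, #(f i) ≤ κ) : #(⋃ i, f i) ≤ κ :=
  (mk_iUnion_le f).trans ((mul_le_mul' hι (ciSup_le' hf)).trans (mul_eq_self hκ).le)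

/-- A compact space whose points are separated by `κ` many continuous functions has weight at
most `κ`. -/
lemma tWeight_le_of_separating {K : Type u} [TopologicalSpace K] [CompactSpace K]
    {κ : Cardinal.{u}} (hκ : ℵ₀ ≤ κ) (D : Set (K → ℝ)) (hD : #D ≤ κ)
    (hcont : ∀ φ ∈ D, Continuous φ) (hsep : ∀ p q, (∀ φ ∈ D, φ p = φ q) → p = q) :
    tWeight K ≤ κ := by
  let e : K → D → ℝ := fun k φ => φ.1 k
  have he : Continuous e := continuous_pi fun φ => hcont φ.1 φ.2
  have hinj : Function.Injective e := fun p q h =>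
    hsep p q fun φ hφ => congrFun h ⟨φ, hφ⟩
  have hind : IsInducing e := (he.isClosedEmbedding hinj).isInducing
  have hb := TopologicalSpace.isBasis_countableBasis ℝ
  have hB := (IsTopologicalBasis.iInf_induced
    (t := fun _ : D => (inferInstance : TopologicalSpace ℝ))
    (T := fun _ : D => TopologicalSpace.countableBasis ℝ) (fun _ => hb)
    (fun φ : D => (φ.1 : K → ℝ)))
  have htop : (⨅ φ : D, TopologicalSpace.induced (φ.1 : K → ℝ) inferInstance) =
      (inferInstance : TopologicalSpace K) := by
    rw [hind.eq_induced, Pi.topologicalSpace, induced_iInf]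
    simp only [induced_compose]
    rfl
  rw [htop] at hB
  classical
  refine tWeight_le_of_basis hκ hB ?_
  refine (mk_le_mk_of_subset (t := range fun G : Finset (D × TopologicalSpace.countableBasis ℝ) =>
    ⋂ x ∈ G, x.1.1 ⁻¹' x.2.1) ?_).trans (mk_range_le.trans (mk_finset_le_of_le hκ ?_))
  · rintro _ ⟨U, F, hU, rfl⟩
    refine ⟨F.attach.image fun i : {i // i ∈ F} => (i.1, ⟨U i.1, hU i.1 i.2⟩), ?_⟩
    ext x
    simp only [mem_iInter, Finset.mem_image, Finset.mem_attach, true_and]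
    constructor
    · intro h i hi
      exact h _ ⟨⟨i, hi⟩, rfl⟩
    · rintro h _ ⟨⟨i, hi⟩, rfl⟩
      exact h i hi
  · rw [mk_prod, lift_uzero]
    refine (mul_le_mul' hD (le_trans ?_ hκ)).trans (mul_eq_self hκ).le
    rw [lift_le_aleph0]
    exact (TopologicalSpace.countable_countableBasis ℝ).le_aleph0

end Weight

section OnePoint

open Set

variable {T : Type u} [TopologicalSpace T] [DiscreteTopology T]

lemma exists_homeomorph_range_elim {A : Type*} [TopologicalSpace A] [T2Space A] (a : T → A)
    (a₀ : A) (ha : Function.Injective a) (hne : ∀ t, a t ≠ a₀) (hlim : Tendsto a cofinite (𝓝 a₀)) :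
    ∃ Z : Set A, IsCompact Z ∧ Nonempty (OnePoint T ≃ₜ Z) := by
  let f : OnePoint T → A := fun z => z.elim a₀ a
  have hf : Continuous f := (OnePoint.continuous_iff_from_discrete f).2 hlim
  have hinj : Function.Injective f := by
    intro x y h
    induction x <;> induction y
    · rfl
    · exact absurd h.symm (hne _)
    · exact absurd h (hne _)
    · exact congrArg _ (ha h)
  exact ⟨range f, isCompact_range hf,
    ⟨(hf.isClosedEmbedding hinj).isEmbedding.toHomeomorph⟩⟩

lemma isValdivia_of_homeomorph_onePoint {Y : Type u} [TopologicalSpace Y] (h : OnePoint T ≃ₜ Y) :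
    IsValdivia Y := by
  classical
  let f : OnePoint T → T → ℝ := fun z => z.elim 0 fun t => Pi.single t 1
  have hf : Continuous f := by
    refine (OnePoint.continuous_iff_from_discrete f).2 (tendsto_pi_nhds.2 fun s => ?_)
    refine tendsto_nhds_of_eventually_eq ?_
    filter_upwards [(finite_singleton s).compl_mem_cofinite] with t ht
    simp [f, Pi.single_eq_of_ne' ht]
  have hinj : Function.Injective f := by
    have hne (t : T) : (Pi.single t 1 : T → ℝ) ≠ 0 := by simp
    intro x y hxy
    induction x <;> induction y
    · rfl
    · exact absurd hxy.symm (hne _)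
    · exact absurd hxy (hne _)
    · rename_i s t
      refine congrArg _ (by_contra fun hst => ?_)
      simpa [f, Pi.single_eq_of_ne hst] using congrFun hxy s
  refine ⟨h.compactSpace, T, range f, isCompact_range hf, ?_,
    ⟨h.symm.trans (hf.isClosedEmbedding hinj).isEmbedding.toHomeomorph⟩⟩
  convert dense_univ
  refine eq_univ_of_forall ?_
  rintro ⟨_, z, rfl⟩
  induction z with
  | infty => simp [f]
  | coe t => exact (countable_singleton t).mono (by simp [f, Pi.single_apply])

lemma isEberlein_of_homeomorph_onePoint {Y : Type u} [TopologicalSpace Y] (h : OnePoint T ≃ₜ Y) :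
    IsEberlein Y := by
  classical
  let E := lp (fun _ : T => ℝ) 2
  let v : T → E := fun t => lp.single 2 t (1 : ℝ)
  have hv (φ : StrongDual ℝ E) : Tendsto (fun t => φ (v t)) cofinite (𝓝 0) := by
    have hs : Summable fun t => ((InnerProductSpace.toDual ℝ E).symm φ t) ^ 2 := by
      simpa using lp.summable_inner (𝕜 := ℝ) ((InnerProductSpace.toDual ℝ E).symm φ)
        ((InnerProductSpace.toDual ℝ E).symm φ)
    have heq (t : T) : φ (v t) = (InnerProductSpace.toDual ℝ E).symm φ t := by
      rw [← InnerProductSpace.toDual_symm_apply, lp.inner_single_right]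
      simp
    simp only [heq]
    rw [tendsto_zero_iff_abs_tendsto_zero]
    have := (Real.continuous_sqrt.tendsto _).comp hs.tendsto_cofinite_zero
    simpa [Function.comp_def, Real.sqrt_sq_eq_abs] using this
  let f : OnePoint T → WeakSpace ℝ E := fun z => z.elim 0 fun t => toWeakSpace ℝ E (v t)
  have hf : Continuous f := by
    refine WeakBilin.continuous_of_continuous_eval _ fun φ => ?_
    refine (OnePoint.continuous_iff_from_discrete _).2 ?_
    have h0 : (topDualPairing ℝ E).flip (f OnePoint.infty) φ = 0 := map_zero φ
    rw [h0]
    exact hv φ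
  have hinj : Function.Injective f := by
    have hne (t : T) : v t ≠ 0 := fun ht => by
      simpa [v] using congrFun (congrArg Subtype.val ht) t
    intro x y hxy
    induction x <;> induction y
    · rfl
    · exact absurd hxy.symm (hne _)
    · exact absurd hxy (hne _)
    · rename_i s t
      refine congrArg _ (by_contra fun hst => ?_)
      have hxy' : v s = v t := hxy
      simpa [v, Pi.single_eq_of_ne hst] using congrFun (congrArg Subtype.val hxy') s
  exact ⟨h.compactSpace, E, inferInstance, inferInstance, inferInstance, range f,
    isCompact_range hf, ⟨h.symm.trans (hf.isClosedEmbedding hinj).isEmbedding.toHomeomorph⟩⟩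

end OnePoint

section Skeleton

/-- `Φ` assigns to finite subsets of `S` countably many continuous functions in such a way that,
for every `M ⊆ S`, the functions assigned to the finite subsets of `M` separate the points of the
closure of `M`. -/
structure IsSeparatingAssignment {K : Type u} [TopologicalSpace K] (S : Set K)
    (Φ : Finset K → Set (K → ℝ)) : Prop where
  dense : Dense S
  countable : ∀ F : Finset K, ↑F ⊆ S → (Φ F).Countable
  continuous : ∀ F, ∀ φ ∈ Φ F, Continuous φ
  separating : ∀ M ⊆ S, ∀ p ∈ closure M, ∀ q ∈ closure M,
    (∀ F : Finset K, ↑F ⊆ M → ∀ φ ∈ Φ F, φ p = φ q) → p = q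

/-- The functions assigned to the finite subsets of `M`. -/
def assigned {K : Type u} (Φ : Finset K → Set (K → ℝ)) (M : Set K) : Set (K → ℝ) :=
  {φ | ∃ F : Finset K, ↑F ⊆ M ∧ φ ∈ Φ F}

lemma assigned_mono {K : Type u} (Φ : Finset K → Set (K → ℝ)) : Monotone (assigned Φ) :=
  fun _ _ h _ ⟨F, hF, hφ⟩ => ⟨F, hF.trans h, hφ⟩

lemma exists_finset_subset_of_directed {α ι : Type*} [Nonempty ι] {M : ι → Set α}
    (hM : Directed (· ⊆ ·) M) (F : Finset α) (hF : ↑F ⊆ ⋃ i, M i) : ∃ i, ↑F ⊆ M i := by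
  exact hM.exists_mem_subset_of_finset_subset_biUnion hF

lemma assigned_iUnion {K : Type u} (Φ : Finset K → Set (K → ℝ)) {ι : Type*} [Nonempty ι]
    {M : ι → Set K} (hM : Directed (· ⊆ ·) M) : assigned Φ (⋃ i, M i) = ⋃ i, assigned Φ (M i) := by
  refine Subset.antisymm ?_ (iUnion_subset fun i => assigned_mono Φ (subset_iUnion M i))
  rintro φ ⟨F, hF, hφ⟩
  obtain ⟨i, hi⟩ := exists_finset_subset_of_directed hM F hF
  exact mem_iUnion.2 ⟨i, F, hi, hφ⟩

/-- The image of `S` under finitely many functions is separable. -/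
lemma exists_countable_approx {K : Type u} (S : Set K) (G : Finset (K → ℝ)) :
    ∃ C ⊆ S, C.Countable ∧ ∀ p ∈ S, ∀ ε > 0, ∃ s ∈ C, ∀ φ ∈ G, |φ s - φ p| < ε := by
  let e : K → G → ℝ := fun k φ => φ.1 k
  obtain ⟨c, hcS, hcc, hc⟩ := (TopologicalSpace.IsSeparable.of_separableSpace
    (e '' S)).exists_countable_dense_subset
  have hinv (x : c) : ∃ s ∈ S, e s = x.1 := hcS x.2
  choose g hgS hg using hinv
  have : Countable c := hcc
  refine ⟨range g, range_subset_iff.2 hgS, countable_range g, fun p hp ε hε => ?_⟩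
  obtain ⟨b, hb, hpb⟩ := Metric.mem_closure_iff.1 (hc (mem_image_of_mem e hp)) ε hε
  refine ⟨g ⟨b, hb⟩, mem_range_self _, fun φ hφ => ?_⟩
  have h1 := (dist_le_pi_dist (e p) b ⟨φ, hφ⟩).trans_lt hpb
  rw [dist_comm] at h1
  have h2 : e (g ⟨b, hb⟩) ⟨φ, hφ⟩ = b ⟨φ, hφ⟩ := congrFun (hg ⟨b, hb⟩) _
  rwa [← h2] at h1

variable {K : Type u} [TopologicalSpace K] {S : Set K} {Φ : Finset K → Set (K → ℝ)}
  {κ : Cardinal.{u}}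

namespace IsSeparatingAssignment

lemma mk_assigned_le (h : IsSeparatingAssignment S Φ) (hκ : ℵ₀ ≤ κ) {M : Set K} (hMS : M ⊆ S)
    (hM : #M ≤ κ) : #(assigned Φ M) ≤ κ := by
  have hsub : assigned Φ M ⊆ ⋃ F : Finset M, Φ (F.map (Function.Embedding.subtype _)) := by
    classical
    rintro φ ⟨F, hF, hφ⟩
    refine mem_iUnion.2 ⟨F.subtype (· ∈ M), ?_⟩
    rwa [Finset.subtype_map_of_mem hF]
  refine (mk_le_mk_of_subset hsub).trans (mk_iUnion_le_of_le hκ (mk_finset_le_of_le hκ hM) ?_)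
  intro F
  refine (le_aleph0_iff_set_countable.2 (h.countable _ ?_)).trans hκ
  intro x hx
  obtain ⟨y, -, rfl⟩ := Finset.mem_map.1 hx
  exact hMS y.2

lemma exists_hull [CompactSpace K] (h : IsSeparatingAssignment S Φ) (hκ : ℵ₀ ≤ κ) {P : Set K}
    (hPS : P ⊆ S) (hP : #P ≤ κ) :
    ∃ M, P ⊆ M ∧ M ⊆ S ∧ #M ≤ κ ∧
      ∀ p ∈ S, ∃ q ∈ closure M, ∀ φ ∈ assigned Φ M, φ q = φ p := by
  choose C hCS hCc hC using exists_countable_approx S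
  let step : Set K → Set K := fun M =>
    M ∪ ⋃ G : Finset (assigned Φ M), C (G.map (Function.Embedding.subtype _))
  let A : ℕ → Set K := fun n => step^[n] P
  have hA_succ (n : ℕ) : A (n + 1) = step (A n) := Function.iterate_succ_apply' _ _ _
  have hA (n : ℕ) : A n ⊆ S ∧ #(A n) ≤ κ := by
    induction n with
    | zero => exact ⟨hPS, hP⟩
    | succ n ih =>
      rw [hA_succ]
      refine ⟨union_subset ih.1 (iUnion_subset fun G => hCS _), ?_⟩
      refine (mk_union_le _ _).trans ((add_le_add ih.2 ?_).trans (add_eq_self hκ).le)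
      refine mk_iUnion_le_of_le hκ (mk_finset_le_of_le hκ (h.mk_assigned_le hκ ih.1 ih.2)) ?_
      exact fun G => (le_aleph0_iff_set_countable.2 (hCc _)).trans hκ
  have hmono : Monotone A := monotone_nat_of_le_succ fun n => by
    rw [hA_succ]
    exact subset_union_left
  have hdir : Directed (· ⊆ ·) A := hmono.directed_le
  refine ⟨⋃ n, A n, subset_iUnion A 0, iUnion_subset fun n => (hA n).1, ?_, fun p hp => ?_⟩
  · rw [← (Equiv.ulift.{u} (α := ℕ)).surjective.iUnion_comp]
    exact mk_iUnion_le_of_le hκ ((mk_le_aleph0_iff.2 inferInstance).trans hκ) fun n => (hA _).2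
  set M := ⋃ n, A n
  let e : K → assigned Φ M → ℝ := fun k φ => φ.1 k
  have he : Continuous e := continuous_pi fun φ => by
    obtain ⟨F, -, hφ⟩ := φ.2
    exact h.continuous F _ hφ
  have hcl : IsClosed (e '' closure M) := (isClosed_closure.isCompact.image he).isClosed
  have hmem : e p ∈ closure (e '' M) := by
    classical
    rw [mem_closure_iff_nhds]
    intro V hV
    rw [nhds_pi, Filter.mem_pi] at hV
    obtain ⟨J, hJ, t, ht, hV⟩ := hV
    have hε : ∀ᶠ ε in 𝓝[>] (0 : ℝ), ∀ φ ∈ J, Metric.ball (e p φ) ε ⊆ t φ := by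
      refine (eventually_all_finite hJ).2 fun φ _ => ?_
      obtain ⟨δ, hδ, hball⟩ := Metric.mem_nhds_iff.1 (ht φ)
      filter_upwards [Ioo_mem_nhdsGT hδ] with ε hε
      exact (Metric.ball_subset_ball hε.2.le).trans hball
    obtain ⟨ε, hε, hε0⟩ := (hε.and self_mem_nhdsWithin).exists
    let G : Finset (K → ℝ) := hJ.toFinset.map (Function.Embedding.subtype _)
    have hG : ↑G ⊆ ⋃ n, assigned Φ (A n) := by
      rw [← assigned_iUnion Φ hdir]
      intro φ hφ
      obtain ⟨ψ, -, rfl⟩ := Finset.mem_map.1 hφ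
      exact ψ.2
    obtain ⟨n, hn⟩ := exists_finset_subset_of_directed
      ((assigned_mono Φ).comp hmono).directed_le G hG
    have hn' : ∀ φ ∈ G, φ ∈ assigned Φ (A n) := hn
    obtain ⟨s, hs, hsp⟩ := hC G p hp ε hε0
    have hsM : s ∈ M := by
      refine mem_iUnion.2 ⟨n + 1, ?_⟩
      rw [hA_succ]
      refine Or.inr (mem_iUnion.2 ⟨G.subtype (· ∈ assigned Φ (A n)), ?_⟩)
      rwa [Finset.subtype_map_of_mem hn']
    refine ⟨e s, hV fun φ hφ => hε φ hφ (hsp φ.1 ?_), mem_image_of_mem e hsM⟩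
    exact Finset.mem_map.2 ⟨φ, hJ.mem_toFinset.2 hφ, rfl⟩
  obtain ⟨q, hq, hqp⟩ := closure_minimal (image_mono subset_closure) hcl hmem
  exact ⟨q, hq, fun φ hφ => congrFun hqp ⟨φ, hφ⟩⟩

lemma exists_step [CompactSpace K] (h : IsSeparatingAssignment S Φ) (hκ : ℵ₀ ≤ κ)
    (hw : κ < tWeight K) {P : Set K} (hPS : P ⊆ S) (hP : #P ≤ κ) :
    ∃ (M : Set K) (p q : K), P ⊆ M ∧ M ⊆ S ∧ #M ≤ κ ∧ p ∈ S ∧ q ∈ closure M ∧ p ≠ q ∧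
      ∀ φ ∈ assigned Φ M, φ p = φ q := by
  obtain ⟨M, hPM, hMS, hM, hMq⟩ := h.exists_hull hκ hPS hP
  have hnot : ¬ S ⊆ closure M := by
    intro hSM
    refine hw.not_ge (tWeight_le_of_separating hκ (assigned Φ M) (h.mk_assigned_le hκ hMS hM)
      (fun φ ⟨F, _, hφ⟩ => h.continuous F φ hφ) fun p q hpq => ?_)
    have huniv (x : K) : x ∈ closure M :=
      closure_minimal hSM isClosed_closure (h.dense x)
    exact h.separating M hMS p (huniv p) q (huniv q) fun F hF φ hφ => hpq φ ⟨F, hF, hφ⟩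
  obtain ⟨p, hpS, hpM⟩ := not_subset.1 hnot
  obtain ⟨q, hq, hqp⟩ := hMq p hpS
  exact ⟨M, p, q, hPM, hMS, hM, hpS, hq, fun hpq => hpM (hpq ▸ hq), fun φ hφ => (hqp φ hφ).symm⟩

/-- There is a long sequence of pairs of distinct points such that every continuous function
oscillates much on finitely many of them only. -/
lemma exists_long_sequence [CompactSpace K] (h : IsSeparatingAssignment S Φ) (hκ : ℵ₀ ≤ κ)
    (hw : κ < tWeight K) :
    ∃ (I : Type u) (p q : I → K), κ < #I ∧ (∀ i, p i ≠ q i) ∧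
      ∀ f : K → ℝ, Continuous f → ∀ ε > 0, {i | ε < |f (p i) - f (q i)|}.Finite := by
  have hstep (P : Set K) : ∃ (M : Set K) (p q : K), P ⊆ S → #P ≤ κ →
      P ⊆ M ∧ M ⊆ S ∧ #M ≤ κ ∧ p ∈ S ∧ q ∈ closure M ∧ p ≠ q ∧
      ∀ φ ∈ assigned Φ M, φ p = φ q := by
    by_cases hP : P ⊆ S ∧ #P ≤ κ
    · obtain ⟨M, p, q, H⟩ := h.exists_step hκ hw hP.1 hP.2
      exact ⟨M, p, q, fun _ _ => H⟩
    · obtain ⟨M, p, q, -⟩ := h.exists_step hκ hw (empty_subset S) (by simp)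
      exact ⟨M, p, q, fun h1 h2 => absurd ⟨h1, h2⟩ hP⟩
  choose M p q H using hstep
  let I := (Order.succ κ).ord.ToType
  let P : I → Set K := WellFoundedLT.fix fun i P => ⋃ j : Iio i, insert (p (P j j.2)) (M (P j j.2))
  have hP (i : I) : P i = ⋃ j : Iio i, insert (p (P j)) (M (P j)) := WellFoundedLT.fix_eq _ i
  have hgood (i : I) : P i ⊆ S ∧ #(P i) ≤ κ := by
    induction i using WellFoundedLT.induction with
    | ind i ih =>
    rw [hP]
    constructor
    · refine iUnion_subset fun j => ?_
      obtain ⟨-, h1, -, h2, -⟩ := H _ (ih j j.2).1 (ih j j.2).2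
      exact insert_subset h2 h1
    · refine mk_iUnion_le_of_le hκ (Order.lt_succ_iff.1 (by simpa [I] using mk_Iio_lt i)) fun j => ?_
      obtain ⟨-, -, h1, -⟩ := H _ (ih j j.2).1 (ih j j.2).2
      exact (mk_insert_le).trans ((add_le_add h1 (one_le_aleph0.trans hκ)).trans
        (add_eq_self hκ).le)
  have HI (i : I) := H (P i) (hgood i).1 (hgood i).2
  have hsub {i j : I} (hij : i < j) : insert (p (P i)) (M (P i)) ⊆ M (P j) := by
    refine Subset.trans ?_ (HI j).1
    rw [hP j]
    exact subset_iUnion (fun j : Iio j => insert (p (P j)) (M (P j))) ⟨i, hij⟩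
  refine ⟨I, fun i => p (P i), fun i => q (P i), by simp [I], fun i => (HI i).2.2.2.2.2.1,
    fun f hf ε hε => ?_⟩
  by_contra hinf
  obtain ⟨a, hmono, ha⟩ : ∃ a : ℕ → I, StrictMono a ∧
      ∀ n, ε < |f (p (P (a n))) - f (q (P (a n)))| := by
    have := Set.Infinite.to_subtype hinf
    obtain ⟨b, hb | hb⟩ := Infinite.exists_strictMono_or_strictAnti
      {i | ε < |f (p (P i)) - f (q (P i))|}
    · exact ⟨fun n => b n, fun m n hmn => hb hmn, fun n => (b n).2⟩
    · exact (not_strictAnti_of_wellFoundedLT b hb).elim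
  let N : Set K := ⋃ n, M (P (a n))
  have hNS : N ⊆ S := iUnion_subset fun n => (HI _).2.1
  have hdir : Directed (· ⊆ ·) fun n => M (P (a n)) :=
    (monotone_nat_of_le_succ fun n =>
      (subset_insert _ _).trans (hsub (hmono n.lt_succ_self))).directed_le
  let U : Ultrafilter ℕ := hyperfilter ℕ
  have hlim (s : ℕ → K) : Tendsto s U (𝓝 (U.map s).lim) := (U.map s).le_nhds_lim
  set x := (U.map fun n => p (P (a n))).lim
  set y := (U.map fun n => q (P (a n))).lim
  have hx : Tendsto (fun n => p (P (a n))) U (𝓝 x) := hlim _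
  have hy : Tendsto (fun n => q (P (a n))) U (𝓝 y) := hlim _
  have hxN : x ∈ closure N := mem_closure_of_tendsto hx <| Eventually.of_forall fun n =>
    mem_iUnion.2 ⟨n + 1, hsub (hmono n.lt_succ_self) (mem_insert _ _)⟩
  have hyN : y ∈ closure N := isClosed_closure.mem_of_tendsto hy <| Eventually.of_forall fun n =>
    closure_mono (subset_iUnion (fun n => M (P (a n))) n) (HI _).2.2.2.2.1
  have hxy : x = y := by
    refine h.separating N hNS x hxN y hyN fun F hF φ hφ => ?_
    obtain ⟨n, hn⟩ := exists_finset_subset_of_directed hdir F hF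
    have hφc := h.continuous F φ hφ
    refine tendsto_nhds_unique ((hφc.tendsto x).comp hx) (((hφc.tendsto y).comp hy).congr' ?_)
    have hev : ∀ᶠ m in (U : Filter ℕ), n ≤ m :=
      Nat.hyperfilter_le_atTop (eventually_ge_atTop n)
    filter_upwards [hev] with m hm
    refine ((HI (a m)).2.2.2.2.2.2 φ ⟨F, hn.trans ?_, hφ⟩).symm
    rcases hm.eq_or_lt with rfl | hm
    · exact Subset.rfl
    · exact (subset_insert _ _).trans (hsub (hmono hm))
  have hlim0 := ((hf.tendsto x).comp hx).sub ((hf.tendsto y).comp hy)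
  rw [hxy, sub_self] at hlim0
  have := ge_of_tendsto hlim0.abs (Eventually.of_forall fun n => (ha n).le)
  simp at this
  exact absurd this hε.not_ge

end IsSeparatingAssignment

end Skeleton

section Examples

lemma IsValdivia.exists_isSeparatingAssignment {Y : Type u} [TopologicalSpace Y]
    (hY : IsValdivia Y) : ∃ (S : Set Y) (Φ : Finset Y → Set (Y → ℝ)),
      IsSeparatingAssignment S Φ := by
  obtain ⟨-, T, Z, -, hZ, ⟨h⟩⟩ := hY
  let ι : Y → T → ℝ := fun y => h y
  have hι : Continuous ι := continuous_subtype_val.comp h.continuous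
  have hcoord (t : T) : Continuous fun y => ι y t := (continuous_apply t).comp hι
  refine ⟨{y | {t | ι y t ≠ 0}.Countable},
    fun F => (fun t y => ι y t) '' ⋃ x ∈ F, {t | ι x t ≠ 0}, ?_, ?_, ?_, ?_⟩
  · exact hZ.preimage h.isOpenMap
  · intro F hF
    exact (F.countable_toSet.biUnion fun x hx => hF hx).image _
  · rintro F _ ⟨t, -, rfl⟩
    exact hcoord t
  · intro M _ p hp q hq hpq
    refine h.injective (Subtype.ext (funext fun t => ?_))
    by_cases ht : ∃ x ∈ M, ι x t ≠ 0
    · obtain ⟨x, hx, hxt⟩ := ht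
      exact hpq {x} (by simpa using hx) (fun y => ι y t) ⟨t, by simpa using hxt, rfl⟩
    · push Not at ht
      have hzero : closure M ⊆ {y | ι y t = 0} :=
        closure_minimal ht (isClosed_eq (hcoord t) continuous_const)
      exact (hzero hp).trans (hzero hq).symm

lemma IsEberlein.exists_isSeparatingAssignment {Y : Type u} [TopologicalSpace Y]
    (hY : IsEberlein Y) : ∃ (S : Set Y) (Φ : Finset Y → Set (Y → ℝ)),
      IsSeparatingAssignment S Φ := by
  obtain ⟨-, E, _, _, _, Z, -, ⟨h⟩⟩ := hY
  let ι : Y → E := fun y => (toWeakSpace ℝ E).symm (h y)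
  have hinj : Function.Injective ι := fun x y hxy =>
    h.injective (Subtype.ext ((toWeakSpace ℝ E).symm.injective hxy))
  have hval : Continuous fun y => ((h y : Z) : WeakSpace ℝ E) :=
    continuous_subtype_val.comp h.continuous
  have hdual (f : StrongDual ℝ E) : Continuous fun y => f (ι y) :=
    (WeakBilin.eval_continuous (topDualPairing ℝ E).flip f).comp hval
  have hsep (F : Finset Y) : ∃ c : Set E, c.Countable ∧
      (Submodule.span ℝ (ι '' F) : Set E) ⊆ closure c :=
    ((F.finite_toSet.image ι).isSeparable).span
  choose c hc hcl using hsep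
  choose g hg hgv using fun v : E => exists_dual_vector'' ℝ v
  refine ⟨univ, fun F => (fun v y => g v (ι y)) '' c F, dense_univ,
    fun F _ => (hc F).image _, ?_, ?_⟩
  · rintro F _ ⟨v, -, rfl⟩
    exact hdual (g v)
  intro M _ p hp q hq hpq
  have hmem (x : Y) (hx : x ∈ closure M) :
      ι x ∈ (Submodule.span ℝ (ι '' M)).topologicalClosure := by
    by_contra hnot
    obtain ⟨f, hf, hfx⟩ : ∃ f : StrongDual ℝ E, (∀ y ∈ M, f (ι y) = 0) ∧ f (ι x) ≠ 0 := by
      obtain ⟨f, u, hlt, hu⟩ := geometric_hahn_banach_closed_point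
        (Submodule.convex _) (Submodule.isClosed_topologicalClosure _) hnot
      have hu0 : 0 < u := by simpa using hlt 0 (Submodule.zero_mem _)
      refine ⟨f, fun y hy => by_contra fun hne => ?_, (hu0.trans hu).ne'⟩
      have hlt' := hlt ((u / f (ι y)) • ι y) (Submodule.smul_mem _ _
        (Submodule.le_topologicalClosure _ (Submodule.subset_span (mem_image_of_mem ι hy))))
      rw [map_smul, smul_eq_mul, div_mul_cancel₀ _ hne] at hlt'
      exact hlt'.false
    exact hfx (closure_minimal hf (isClosed_eq (hdual f) continuous_const) hx)
  refine hinj (sub_eq_zero.1 (by_contra fun hne => ?_))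
  set w := ι p - ι q
  have hw : w ∈ closure (Submodule.span ℝ (ι '' M) : Set E) :=
    Submodule.sub_mem _ (hmem p hp) (hmem q hq)
  have hpos : 0 < ‖w‖ / 4 := by positivity
  obtain ⟨w', hw', hww'⟩ := Metric.mem_closure_iff.1 hw _ hpos
  obtain ⟨F, hFM, hF⟩ : ∃ F : Finset Y, ↑F ⊆ M ∧ w' ∈ Submodule.span ℝ (ι '' F) := by
    classical
    obtain ⟨G, hG, hG'⟩ := Submodule.mem_span_finite_of_mem_span hw'
    obtain ⟨F, hF, rfl⟩ := Finset.subset_set_image_iff.1 hG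
    exact ⟨F, hF, by simpa using hG'⟩
  obtain ⟨v, hv, hwv⟩ := Metric.mem_closure_iff.1 (hcl F hF) _ hpos
  have hzero : g v w = 0 := by
    rw [map_sub, sub_eq_zero]
    exact hpq F hFM _ ⟨v, hv, rfl⟩
  have hdist : ‖v - w‖ < ‖w‖ / 2 := by
    rw [← dist_eq_norm, dist_comm]
    linarith [dist_triangle w w' v]
  have hnorm : ‖v‖ ≤ ‖v - w‖ := by
    have h1 : g v (v - w) = ‖v‖ := by rw [map_sub, hzero, sub_zero, hgv]; rfl
    calc ‖v‖ = g v (v - w) := h1.symm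
      _ ≤ ‖g v (v - w)‖ := le_abs_self _
      _ ≤ ‖v - w‖ := (g v).le_of_opNorm_le (hg v) _ |>.trans (one_mul _).le
  linarith [norm_sub_norm_le w v, norm_sub_rev w v]

end Examples

section Main

variable {X : Type u} [TopologicalSpace X]

lemma functionallyOpen_setOf_lt_abs_sub {f g : X → ℝ} (hf : Continuous f) (hg : Continuous g)
    (ε : ℝ) : FunctionallyOpen {x | ε < |f x - g x|} := by
  refine ⟨fun x => min 1 (max 0 (|f x - g x| - ε)), by fun_prop, fun x => ?_, ?_⟩
  · exact ⟨le_min zero_le_one (le_max_left _ _), min_le_left _ _⟩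
  · ext x
    simp

lemma exists_homeomorph_onePoint {T : Type u} [TopologicalSpace T] [DiscreteTopology T]
    {U : T → Set X} (hU : Function.Injective U) (hne : ∀ t, (U t).Nonempty)
    (hopen : ∀ t, FunctionallyOpen (U t)) (hfin : ∀ x, {t | x ∈ U t}.Finite) :
    ∃ Y : Set (Cp X), Nonempty (OnePoint T ≃ₜ Y) := by
  choose g hgc hg01 hgU using hopen
  have hmem (t : T) (x : X) : x ∈ U t ↔ g t x ≠ 0 := by
    conv_lhs => rw [hgU t]
    exact ⟨fun h => h.1.ne', fun h => ⟨(hg01 t x).1.lt_of_ne' h, (hg01 t x).2⟩⟩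
  let a : T → Cp X := fun t => ⟨g t, hgc t⟩
  let a₀ : Cp X := ⟨fun _ => 0, continuous_const⟩
  have ha : Function.Injective a := by
    intro s t hst
    refine hU (Set.ext fun x => ?_)
    rw [hmem, hmem, show g s = g t from congrArg Subtype.val hst]
  have ha₀ (t : T) : a t ≠ a₀ := by
    intro ht
    obtain ⟨x, hx⟩ := hne t
    exact (hmem t x).1 hx (congrFun (congrArg Subtype.val ht) x)
  have hlim : Tendsto a cofinite (𝓝 a₀) := by
    refine tendsto_subtype_rng.2 (tendsto_pi_nhds.2 fun x => tendsto_nhds_of_eventually_eq ?_)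
    filter_upwards [(hfin x).compl_mem_cofinite] with t ht
    exact not_not.1 fun h => ht ((hmem t x).2 h)
  obtain ⟨Z, -, hZ⟩ := exists_homeomorph_range_elim a a₀ ha ha₀ hlim
  exact ⟨Z, hZ⟩

lemma mk_le_of_forall_onePoint {κ : Cardinal.{u}}
    (h : ∀ (T : Type u) [TopologicalSpace T] [DiscreteTopology T] (Y : Set (Cp X)),
      Nonempty (OnePoint T ≃ₜ Y) → tWeight Y ≤ κ)
    (𝒰 : Set (Set X)) (h𝒰 : ∀ U ∈ 𝒰, U.Nonempty ∧ FunctionallyOpen U) (hfin : PointFinite 𝒰) :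
    #𝒰 ≤ κ := by
  let _ : TopologicalSpace 𝒰 := ⊥
  have : DiscreteTopology 𝒰 := ⟨rfl⟩
  obtain ⟨Y, ⟨e⟩⟩ := exists_homeomorph_onePoint (U := fun U : 𝒰 => U.1) Subtype.val_injective
    (fun U => (h𝒰 U U.2).1) (fun U => (h𝒰 U U.2).2) fun x =>
      Finite.of_finite_image ((hfin x).subset (by rintro _ ⟨U, hU, rfl⟩; exact ⟨U.2, hU⟩))
        Subtype.val_injective.injOn
  refine (mk_le_tWeight (fun U : 𝒰 => e (U : OnePoint 𝒰))
    (e.injective.comp OnePoint.coe_injective) fun U => ?_).trans (h 𝒰 Y ⟨e⟩)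
  rw [← image_singleton, e.isOpen_image, ← image_singleton, OnePoint.isOpen_image_coe]
  exact isOpen_discrete _

lemma mk_le_of_pointFinite {κ : Cardinal.{u}} (hκ : ℵ₀ ≤ κ)
    (h : ∀ 𝒰 : Set (Set X), (∀ U ∈ 𝒰, U.Nonempty ∧ FunctionallyOpen U) → PointFinite 𝒰 →
      #𝒰 ≤ κ)
    {J : Type u} (U : J → Set X) (hne : ∀ j, (U j).Nonempty) (hopen : ∀ j, FunctionallyOpen (U j))
    (hfin : ∀ x, {j | x ∈ U j}.Finite) : #J ≤ κ := by
  have hrange : #(range U) ≤ κ := by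
    refine h _ ?_ fun x => ?_
    · rintro _ ⟨j, rfl⟩
      exact ⟨hne j, hopen j⟩
    · refine ((hfin x).image U).subset ?_
      rintro _ ⟨⟨j, rfl⟩, hx⟩
      exact ⟨j, hx, rfl⟩
  rw [← mk_univ]
  have : (univ : Set J) = ⋃ V : range U, {j | U j = V} := by
    ext j
    simp
  rw [this]
  refine mk_iUnion_le_of_le hκ hrange ?_
  rintro ⟨_, j, rfl⟩
  obtain ⟨x, hx⟩ := hne j
  have : {i | U i = U j}.Finite := (hfin x).subset fun i (hi : U i = U j) => by
    simpa only [mem_ofPred_eq, hi] using hx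
  exact this.countable.le_aleph0.trans hκ

lemma tWeight_le_of_isSeparatingAssignment {κ : Cardinal.{u}} (hκ : ℵ₀ ≤ κ)
    (h : ∀ 𝒰 : Set (Set X), (∀ U ∈ 𝒰, U.Nonempty ∧ FunctionallyOpen U) → PointFinite 𝒰 →
      #𝒰 ≤ κ)
    (Y : Set (Cp X)) [CompactSpace Y] {S : Set Y} {Φ : Finset Y → Set (Y → ℝ)}
    (hS : IsSeparatingAssignment S Φ) : tWeight Y ≤ κ := by
  by_contra hw
  obtain ⟨I, p, q, hI, hpq, hosc⟩ := hS.exists_long_sequence hκ (not_le.1 hw)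
  have hx (i : I) : ∃ x, (p i).1.1 x ≠ (q i).1.1 x := by
    by_contra! hx
    exact hpq i (Subtype.ext (Subtype.ext (funext hx)))
  choose x hx using hx
  let ε : ℕ → ℝ := fun n => 1 / (n + 1)
  let J : ℕ → Set I := fun n => {i | ε n < |(p i).1.1 (x i) - (q i).1.1 (x i)|}
  have hJ (n : ℕ) : #(J n) ≤ κ := by
    refine mk_le_of_pointFinite hκ h
      (fun i : J n => {y | ε n < |(p i).1.1 y - (q i).1.1 y|}) (fun i => ⟨x i, i.2⟩)
      (fun i => functionallyOpen_setOf_lt_abs_sub (p i).1.2 (q i).1.2 _) fun y => ?_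
    have := hosc (fun f => f.1.1 y)
      ((continuous_apply y).comp (continuous_subtype_val.comp continuous_subtype_val)) (ε n)
      Nat.one_div_pos_of_nat
    exact Finite.preimage (f := Subtype.val) (s := {i | ε n < |(p i).1.1 y - (q i).1.1 y|})
      Subtype.val_injective.injOn this
  have hcover : (univ : Set I) = ⋃ n : ULift.{u} ℕ, J n.down := by
    refine (eq_univ_of_forall fun i => ?_).symm
    obtain ⟨n, hn⟩ := exists_nat_one_div_lt (abs_pos.2 (sub_ne_zero.2 (hx i)))
    exact mem_iUnion.2 ⟨⟨n⟩, hn⟩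
  refine hI.not_ge ?_
  rw [← mk_univ, hcover]
  exact mk_iUnion_le_of_le hκ ((mk_le_aleph0_iff.2 inferInstance).trans hκ) fun n => hJ _

end Main

/-- Theorem 3.1: for a topological space `X` and an infinite cardinal `κ`, the following
are equivalent: (i) every point-finite family of nonempty functionally open subsets of
`X` has cardinality at most `κ`; (ii) every Valdivia compact subspace of `C_p(X)` has
weight at most `κ`; (iii) every Eberlein compact subspace of `C_p(X)` has weight at most
`κ`. -/
theorem stmt_3 (X : Type u) [TopologicalSpace X] (κ : Cardinal.{u})
    (hκ : Cardinal.aleph0 ≤ κ) :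
    List.TFAE
      [∀ 𝒰 : Set (Set X), (∀ U ∈ 𝒰, U.Nonempty ∧ FunctionallyOpen U) → PointFinite 𝒰 →
        Cardinal.mk ↥𝒰 ≤ κ,
       ∀ Y : Set ↥(Cp X), IsValdivia ↥Y → tWeight ↥Y ≤ κ,
       ∀ Y : Set ↥(Cp X), IsEberlein ↥Y → tWeight ↥Y ≤ κ] := by
  tfae_have 1 → 2 := fun h Y hY => by
    have := hY.1
    obtain ⟨S, Φ, hS⟩ := hY.exists_isSeparatingAssignment
    exact tWeight_le_of_isSeparatingAssignment hκ h Y hS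
  tfae_have 1 → 3 := fun h Y hY => by
    have := hY.1
    obtain ⟨S, Φ, hS⟩ := hY.exists_isSeparatingAssignment
    exact tWeight_le_of_isSeparatingAssignment hκ h Y hS
  tfae_have 2 → 1 := fun h => mk_le_of_forall_onePoint fun T _ _ Y ⟨e⟩ =>
    h Y (isValdivia_of_homeomorph_onePoint e)
  tfae_have 3 → 1 := fun h => mk_le_of_forall_onePoint fun T _ _ Y ⟨e⟩ =>
    h Y (isEberlein_of_homeomorph_onePoint e)
  tfae_finish
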